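/- arXiv:2109.00871 — 2 statements merged into one kernel-verified Lean document; each statement's English description precedes it below -/
import Mathlib

section
/- Let f : ℝⁿ → ℝ ∪ {+∞} be a proper convex lower semicontinuous function with 0 < ∫ e^{-f(x)} dx · ∫ e^{-f*(x)} dx < ∞. For k ≥ 1 define V_k(x) = (f □ (k|·|²/2))(x) + |x|²/(2k), where □ denotes infimum convolution: (g □ h)(x) = inf_y (g(y) + h(x−y)). Then V_k is convex and real-valued on ℝⁿ, its Fenchel-Legendre transform satisfies V_k*(y) = ((f* + |·|²/(2k)) □ (k|·|²/2))(y) and is real-valued on ℝⁿ, and as k → ∞, ∫ e^{-V_k(x)} dx → ∫ e^{-f(x)} dx and ∫ e^{-V_k*(x)} dx → ∫ e^{-f*(x)} dx. -/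
open MeasureTheory Real Set Filter
open scoped ENNReal InnerProductSpace Topology

noncomputable section

variable {E : Type*} [NormedAddCommGroup E] [InnerProductSpace ℝ E]

/-- `exp (-t)` for an extended-real `t`, with the convention that it is `0` at `⊤`
(proper functions never take the value `⊥`; we also set the value at `⊥` to `0`). -/
def expNeg (t : EReal) : ℝ := if t = ⊤ then 0 else if t = ⊥ then 0 else Real.exp (-t.toReal)

/-- Convexity for extended-real-valued functions. -/
def ConvexEReal (f : E → EReal) : Prop :=
  ∀ x y : E, ∀ a b : ℝ, 0 ≤ a → 0 ≤ b → a + b = 1 →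
    f (a • x + b • y) ≤ (a : EReal) * f x + (b : EReal) * f y

/-- The class `𝓕` of proper convex lower semicontinuous functions `E → ℝ ∪ {+∞}`. -/
def IsProperConvexLSC (f : E → EReal) : Prop :=
  ConvexEReal f ∧ LowerSemicontinuous f ∧ (∀ x, f x ≠ ⊥) ∧ (∃ x, f x ≠ ⊤)

/-- Fenchel-Legendre transform of an extended-real-valued function. -/
def fenchel (f : E → EReal) (y : E) : EReal := ⨆ x : E, (⟪x, y⟫_ℝ : EReal) - f x

/-- Infimum convolution of two extended-real-valued functions. -/
def infConv (g h : E → EReal) (x : E) : EReal := ⨅ y : E, g y + h (x - y)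

/-- The Moreau-Yosida-type regularization `V_k = (f □ k|·|²/2) + |·|²/(2k)`. -/
def MYreg (f : E → EReal) (k : ℕ) (x : E) : EReal :=
  infConv f (fun z => (((k : ℝ) * ‖z‖ ^ 2 / 2 : ℝ) : EReal)) x + ((‖x‖ ^ 2 / (2 * k) : ℝ) : EReal)

theorem EReal.coe_sub_le_coe_iff_forall {t : EReal} {a c : ℝ} :
    (a : EReal) - t ≤ c ↔ ∀ r : ℝ, t ≤ r → a - r ≤ c := by
  induction t with
  | bot =>
    simp only [EReal.sub_bot (EReal.coe_ne_bot a), top_le_iff, EReal.coe_ne_top, bot_le,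
      forall_const, false_iff, not_forall]
    exact ⟨a - c - 1, by linarith⟩
  | coe t =>
    norm_cast
    exact ⟨fun h r hr => by linarith, fun h => h t le_rfl⟩
  | top => simp

theorem EReal.coe_le_add_coe_iff_forall {t : EReal} {a c : ℝ} :
    (c : EReal) ≤ t + a ↔ ∀ r : ℝ, t ≤ r → c ≤ r + a := by
  induction t with
  | bot =>
    simp only [EReal.bot_add, le_bot_iff, EReal.coe_ne_bot, bot_le, forall_const, false_iff,
      not_forall]
    exact ⟨c - a - 1, by linarith⟩
  | coe t =>
    norm_cast
    exact ⟨fun h r hr => by linarith, fun h => h t le_rfl⟩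
  | top => simp

theorem fenchel_le_coe_iff {f : E → EReal} {y : E} {c : ℝ} :
    fenchel f y ≤ c ↔ ∀ x, ∀ r : ℝ, f x ≤ r → ⟪x, y⟫_ℝ - r ≤ c := by
  simp only [fenchel, iSup_le_iff, EReal.coe_sub_le_coe_iff_forall]

theorem coe_le_infConv_iff {F : Type*} [NormedAddCommGroup F] {f : F → EReal} {q : F → ℝ} {x : F}
    {c : ℝ} :
    (c : EReal) ≤ infConv f (fun z => (q z : EReal)) x ↔
      ∀ u, ∀ r : ℝ, f u ≤ r → c ≤ r + q (x - u) := by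
  simp only [infConv, le_iInf_iff, EReal.coe_le_add_coe_iff_forall]

theorem infConv_le_coe {F : Type*} [NormedAddCommGroup F] {f : F → EReal} {q : F → ℝ} {x u : F} {r : ℝ}
    (h : f u ≤ r) :
    infConv f (fun z => (q z : EReal)) x ≤ ((r + q (x - u) : ℝ) : EReal) := by
  refine (iInf_le _ u).trans ?_
  rw [EReal.coe_add]
  gcongr

theorem exists_le_of_ne_top {t : EReal} (h : t ≠ ⊤) : ∃ r : ℝ, t ≤ r :=
  ⟨t.toReal, EReal.le_coe_toReal h⟩

/-- The epigraph of a convex function with values in the extended reals is convex. -/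
theorem ConvexEReal.convex_epigraph {f : E → EReal} (hf : ConvexEReal f) :
    Convex ℝ {p : E × ℝ | f p.1 ≤ p.2} := by
  rintro ⟨x, r⟩ hx ⟨y, s⟩ hy a b ha hb hab
  change f x ≤ r at hx
  change f y ≤ s at hy
  refine (hf x y a b ha hb hab).trans ?_
  simp only [Prod.snd_add, Prod.smul_snd, smul_eq_mul, EReal.coe_add, EReal.coe_mul]
  exact add_le_add (mul_le_mul_of_nonneg_left hx (mod_cast ha))
    (mul_le_mul_of_nonneg_left hy (mod_cast hb))

theorem ConvexOn.convexEReal {m : E → ℝ} (hm : ConvexOn ℝ univ m) :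
    ConvexEReal (fun x => (m x : EReal)) := by
  intro x y a b ha hb hab
  change ((m _ : ℝ) : EReal) ≤ a * (m x : EReal) + b * (m y : EReal)
  exact_mod_cast hm.2 (mem_univ x) (mem_univ y) ha hb hab

theorem convex_epigraph_fenchel (f : E → EReal) :
    Convex ℝ {p : E × ℝ | fenchel f p.1 ≤ p.2} := by
  simp only [fenchel_le_coe_iff]
  rintro ⟨y, c⟩ hy ⟨z, d⟩ hz a b ha hb hab x r hr
  have h1 := mul_le_mul_of_nonneg_left (hy x r hr) ha
  have h2 := mul_le_mul_of_nonneg_left (hz x r hr) hb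
  simp only [Prod.fst_add, Prod.smul_fst, Prod.snd_add, Prod.smul_snd, smul_eq_mul,
    inner_add_right, inner_smul_right] at *
  have : r = a * r + b * r := by rw [← add_mul, hab, one_mul]
  linarith

theorem lowerSemicontinuous_fenchel (f : E → EReal) : LowerSemicontinuous (fenchel f) := by
  refine lowerSemicontinuous_iSup fun x => ?_
  induction f x with
  | bot => simpa [EReal.sub_bot] using lowerSemicontinuous_const
  | coe t =>
    refine Continuous.lowerSemicontinuous ?_
    simp_rw [← EReal.coe_sub]
    exact continuous_coe_real_ereal.comp (by fun_prop)
  | top => simpa using lowerSemicontinuous_const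

/-- Young's inequality for the scaled Euclidean norm. -/
theorem real_inner_le_scaled_sq (x y : E) {k : ℝ} (hk : 0 < k) :
    ⟪x, y⟫_ℝ ≤ k * ‖x‖ ^ 2 / 2 + ‖y‖ ^ 2 / (2 * k) := by
  refine (real_inner_le_norm _ _).trans ?_
  rw [← sub_nonneg]
  have : k * ‖x‖ ^ 2 / 2 + ‖y‖ ^ 2 / (2 * k) - ‖x‖ * ‖y‖ = (k * ‖x‖ - ‖y‖) ^ 2 / (2 * k) := by
    field_simp; ring
  rw [this]; positivity

theorem le_infConv_of_fenchel_le {f : E → EReal} {z : E} {c : ℝ} (hc : fenchel f z ≤ c)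
    {k : ℝ} (hk : 0 < k) (x : E) :
    ((⟪x, z⟫_ℝ - c - ‖z‖ ^ 2 / (2 * k) : ℝ) : EReal) ≤
      infConv f (fun z => ((k * ‖z‖ ^ 2 / 2 : ℝ) : EReal)) x := by
  refine (coe_le_infConv_iff (q := fun z => k * ‖z‖ ^ 2 / 2)).2 fun u r hr => ?_
  have h1 := fenchel_le_coe_iff.1 hc u r hr
  have h2 := real_inner_le_scaled_sq (x - u) z hk
  rw [inner_sub_left] at h2
  linarith

theorem fenchel_ne_bot {f : E → EReal} {x : E} (hx : f x ≠ ⊤) (y : E) : fenchel f y ≠ ⊥ := by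
  intro h
  obtain ⟨r, hr⟩ := exists_le_of_ne_top hx
  have h1 : fenchel f y ≤ ((⟪x, y⟫_ℝ - r - 1 : ℝ) : EReal) := h ▸ bot_le
  have h2 := fenchel_le_coe_iff.1 h1 x r hr
  linarith

theorem fenchel_fenchel_ne_top {f : E → EReal} {x : E} (hx : f x ≠ ⊤) :
    fenchel (fenchel f) x ≠ ⊤ := by
  obtain ⟨r, hr⟩ := exists_le_of_ne_top hx
  have h : fenchel (fenchel f) x ≤ r := fenchel_le_coe_iff.2 fun y c hc => by
    have := fenchel_le_coe_iff.1 hc x r hr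
    rw [real_inner_comm] at this
    linarith
  exact (h.trans_lt (EReal.coe_lt_top r)).ne

/-- A Moreau-Yosida regularization of a convex function with an affine minorant is finite and
convex. -/
theorem exists_convexOn_infConv_eq {f : E → EReal} (hf : Convex ℝ {p : E × ℝ | f p.1 ≤ p.2})
    {x₁ : E} (hx₁ : f x₁ ≠ ⊤) {y₀ : E} (hy₀ : fenchel f y₀ ≠ ⊤) {k : ℝ} (hk : 0 < k) :
    ∃ m : E → ℝ, ConvexOn ℝ univ m ∧
      ∀ x, infConv f (fun z => ((k * ‖z‖ ^ 2 / 2 : ℝ) : EReal)) x = m x := by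
  obtain ⟨r₁, hr₁⟩ := exists_le_of_ne_top hx₁
  obtain ⟨c, hc⟩ := exists_le_of_ne_top hy₀
  set M := infConv f (fun z => ((k * ‖z‖ ^ 2 / 2 : ℝ) : EReal)) with hM
  have htop : ∀ x, M x ≠ ⊤ := fun x =>
    ((infConv_le_coe hr₁).trans_lt (EReal.coe_lt_top _)).ne
  have hbot : ∀ x, M x ≠ ⊥ := by
    intro x
    exact ((EReal.bot_lt_coe _).trans_le (le_infConv_of_fenchel_le hc hk x)).ne'
  have hm : ∀ x, M x = ((M x).toReal : EReal) := fun x =>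
    (EReal.coe_toReal (htop x) (hbot x)).symm
  have happrox : ∀ x, ∀ ε > 0, ∃ u, ∃ r : ℝ, f u ≤ r ∧
      r + k * ‖x - u‖ ^ 2 / 2 < (M x).toReal + ε := by
    intro x ε hε
    by_contra! h
    have h2 := coe_le_infConv_iff (q := fun z => k * ‖z‖ ^ 2 / 2).2 h
    have h3 := EReal.coe_le_coe_iff.1 (h2.trans (hm x).le)
    linarith
  refine ⟨fun x => (M x).toReal, ⟨convex_univ, ?_⟩, hm⟩
  intro x _ y _ a b ha hb hab
  refine le_of_forall_pos_le_add fun ε hε => ?_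
  obtain ⟨u, r, hu, hur⟩ := happrox x ε hε
  obtain ⟨v, s, hv, hvs⟩ := happrox y ε hε
  have hle := hf (x := (u, r)) (y := (v, s)) hu hv ha hb hab
  have h1 : M (a • x + b • y) ≤ _ :=
    infConv_le_coe (q := fun z => k * ‖z‖ ^ 2 / 2) (x := a • x + b • y) hle
  rw [hm, EReal.coe_le_coe_iff] at h1
  refine h1.trans ?_
  have h2 : a • x + b • y - (a • (u, r) + b • (v, s)).1 = a • (x - u) + b • (y - v) := by
    simp only [Prod.fst_add, Prod.smul_fst, smul_sub]; abel
  have h3 : ‖a • (x - u) + b • (y - v)‖ ^ 2 ≤ a * ‖x - u‖ ^ 2 + b * ‖y - v‖ ^ 2 :=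
    ((convexOn_norm convex_univ).pow (fun _ _ => norm_nonneg _) 2).2 (mem_univ (x - u))
      (mem_univ (y - v)) ha hb hab
  rw [h2]
  simp only [Prod.snd_add, Prod.smul_snd, smul_eq_mul]
  have h4 := mul_le_mul_of_nonneg_left h3 (by positivity : 0 ≤ k / 2)
  have h5 := mul_le_mul_of_nonneg_left hur.le ha
  have h6 := mul_le_mul_of_nonneg_left hvs.le hb
  have h7 : ε = a * ε + b * ε := by rw [← add_mul, hab, one_mul]
  linarith

/-- A convex function plus `|·|² / (2k) - ⟪·, y⟫` is minimized at `x₀` only if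
`y - x₀ / k` is a subgradient of the function at `x₀`. -/
theorem ConvexOn.subgradient_of_forall_le {m : E → ℝ} (hm : ConvexOn ℝ univ m) {k : ℝ}
    {x₀ y : E}
    (hmin : ∀ x, m x₀ + ‖x₀‖ ^ 2 / (2 * k) - ⟪x₀, y⟫_ℝ ≤ m x + ‖x‖ ^ 2 / (2 * k) - ⟪x, y⟫_ℝ)
    (v : E) :
    m x₀ - ⟪x₀, y - k⁻¹ • x₀⟫_ℝ ≤ m v - ⟪v, y - k⁻¹ • x₀⟫_ℝ := by
  set A := m v - ⟪v, y - k⁻¹ • x₀⟫_ℝ - (m x₀ - ⟪x₀, y - k⁻¹ • x₀⟫_ℝ) with hA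
  have key : ∀ t ∈ Ioo (0 : ℝ) 1, 0 ≤ A + t * (‖v - x₀‖ ^ 2 / (2 * k)) := by
    rintro t ⟨ht0, ht1⟩
    have h1 := hmin (x₀ + t • (v - x₀))
    have h2 := hm.2 (mem_univ x₀) (mem_univ v) (by linarith : 0 ≤ 1 - t) ht0.le (by ring)
    have h3 : (1 - t) • x₀ + t • v = x₀ + t • (v - x₀) := by module
    have h4 : ‖x₀ + t • (v - x₀)‖ ^ 2 =
        ‖x₀‖ ^ 2 + 2 * t * (⟪v, x₀⟫_ℝ - ‖x₀‖ ^ 2) + t ^ 2 * ‖v - x₀‖ ^ 2 := by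
      rw [norm_add_sq_real, norm_smul, mul_pow, inner_smul_right, inner_sub_right,
        real_inner_self_eq_norm_sq, real_inner_comm, Real.norm_eq_abs, sq_abs]
      ring
    rw [h3] at h2
    rw [h4, inner_add_left, real_inner_smul_left, inner_sub_left] at h1
    simp only [smul_eq_mul] at h2
    have h5 : A = m v - m x₀ - (⟪v, y⟫_ℝ - ⟪x₀, y⟫_ℝ) + k⁻¹ * (⟪v, x₀⟫_ℝ - ‖x₀‖ ^ 2) := by
      simp only [hA, inner_sub_right, inner_smul_right, real_inner_self_eq_norm_sq]
      ring
    refine le_of_mul_le_mul_left ?_ ht0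
    rw [h5]
    have h6 : (‖x₀‖ ^ 2 + 2 * t * (⟪v, x₀⟫_ℝ - ‖x₀‖ ^ 2) + t ^ 2 * ‖v - x₀‖ ^ 2) / (2 * k)
        = ‖x₀‖ ^ 2 / (2 * k) + t * (k⁻¹ * (⟪v, x₀⟫_ℝ - ‖x₀‖ ^ 2))
          + t * (t * (‖v - x₀‖ ^ 2 / (2 * k))) := by
      simp only [div_eq_mul_inv, mul_inv]; ring
    rw [h6] at h1
    linarith
  have hlim : Tendsto (fun t : ℝ => A + t * (‖v - x₀‖ ^ 2 / (2 * k))) (𝓝[>] 0) (𝓝 A) := by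
    have : Continuous fun t : ℝ => A + t * (‖v - x₀‖ ^ 2 / (2 * k)) := by fun_prop
    simpa using (this.tendsto 0).mono_left nhdsWithin_le_nhds
  have := ge_of_tendsto hlim (by
    filter_upwards [Ioo_mem_nhdsGT (zero_lt_one' ℝ)] with t ht using key t ht)
  linarith

theorem tendsto_cocompact_norm_sq_sub_atTop [FiniteDimensional ℝ E] {a : ℝ} (ha : 0 < a)
    (b c : ℝ) : Tendsto (fun x : E => a * ‖x‖ ^ 2 - b * ‖x‖ - c) (cocompact E) atTop := by
  have h : Tendsto (fun t : ℝ => t * (a * t - b) - c) atTop atTop :=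
    tendsto_atTop_add_const_right _ _ (tendsto_id.atTop_mul_atTop₀
      (tendsto_atTop_add_const_right _ _ (tendsto_id.const_mul_atTop ha)))
  refine (h.comp (tendsto_norm_cocompact_atTop (E := E))).congr fun x => ?_
  simp only [Function.comp]
  ring

/-- The conjugate of `V_k = (f □ k|·|²/2) + |·|²/(2k)` is `(f* + |·|²/(2k)) □ k|·|²/2`. -/
theorem fenchel_MYreg [FiniteDimensional ℝ E] {f : E → EReal}
    (hf : Convex ℝ {p : E × ℝ | f p.1 ≤ p.2}) {x₁ : E} (hx₁ : f x₁ ≠ ⊤)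
    {y₀ : E} (hy₀ : fenchel f y₀ ≠ ⊤) {k : ℕ} (hk : 1 ≤ k) (y : E) :
    fenchel (MYreg f k) y = infConv (fun z => fenchel f z + ((‖z‖ ^ 2 / (2 * k) : ℝ) : EReal))
      (fun z => (((k : ℝ) * ‖z‖ ^ 2 / 2 : ℝ) : EReal)) y := by
  have hk0 : (0 : ℝ) < k := by exact_mod_cast hk
  obtain ⟨m, hm, hmf⟩ := exists_convexOn_infConv_eq hf hx₁ hy₀ hk0
  have hV : ∀ x, MYreg f k x = ((m x + ‖x‖ ^ 2 / (2 * k) : ℝ) : EReal) := fun x => by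
    rw [MYreg, hmf, EReal.coe_add]
  apply le_antisymm
  · refine le_iInf fun z => ?_
    have hbot := fenchel_ne_bot hx₁ z
    change _ ≤ fenchel f z + _ + ((_ : ℝ) : EReal)
    generalize hc : fenchel f z = c at *
    induction c with
    | bot => exact absurd rfl hbot
    | top => simp
    | coe c =>
      have hlow := le_infConv_of_fenchel_le hc.le hk0
      simp only [← EReal.coe_add]
      refine fenchel_le_coe_iff.2 fun x r hr => ?_
      have h1 := hlow x
      rw [hmf, EReal.coe_le_coe_iff] at h1
      rw [hV, EReal.coe_le_coe_iff] at hr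
      have h2 := real_inner_le_scaled_sq (y - z) x hk0
      rw [real_inner_comm, inner_sub_right] at h2
      linarith
  · obtain ⟨c₀, hc₀⟩ := exists_le_of_ne_top hy₀
    have hcont : Continuous fun x => m x + ‖x‖ ^ 2 / (2 * k) - ⟪x, y⟫_ℝ := by
      have := hm.locallyLipschitz.continuous
      fun_prop
    obtain ⟨x₀, hmin⟩ := hcont.exists_forall_le (by
      refine tendsto_atTop_mono (fun x => ?_) (tendsto_cocompact_norm_sq_sub_atTop
        (E := E) (by positivity : 0 < 1 / (2 * (k : ℝ))) (‖y - y₀‖)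
          (c₀ + ‖y₀‖ ^ 2 / (2 * k)))
      have h1 := le_infConv_of_fenchel_le hc₀ hk0 x
      rw [hmf, EReal.coe_le_coe_iff] at h1
      have h2 := real_inner_le_norm x (y - y₀)
      rw [inner_sub_right] at h2
      have h3 : 1 / (2 * (k : ℝ)) * ‖x‖ ^ 2 = ‖x‖ ^ 2 / (2 * k) := by ring
      linarith)
    have hsub := hm.subgradient_of_forall_le hmin
    set z := y - (k : ℝ)⁻¹ • x₀ with hz
    have hfz : fenchel f z ≤ ((⟪x₀, z⟫_ℝ - m x₀ - ‖z‖ ^ 2 / (2 * k) : ℝ) : EReal) := by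
      refine fenchel_le_coe_iff.2 fun u r hr => ?_
      have h1 := hsub (u + (k : ℝ)⁻¹ • z)
      have h2 := infConv_le_coe (q := fun z => (k : ℝ) * ‖z‖ ^ 2 / 2)
        (x := u + (k : ℝ)⁻¹ • z) hr
      rw [hmf, EReal.coe_le_coe_iff] at h2
      rw [inner_add_left, real_inner_smul_left, real_inner_self_eq_norm_sq] at h1
      simp only [add_sub_cancel_left, norm_smul, mul_pow, norm_inv, Real.norm_natCast] at h2
      have h3 : (k : ℝ) * ((k : ℝ)⁻¹ ^ 2 * ‖z‖ ^ 2) / 2 = ‖z‖ ^ 2 / (2 * k) := by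
        field_simp
      have h4 : (k : ℝ)⁻¹ * ‖z‖ ^ 2 = 2 * (‖z‖ ^ 2 / (2 * k)) := by field_simp
      linarith
    have hle : fenchel f z + ((‖z‖ ^ 2 / (2 * k) : ℝ) : EReal) ≤
        ((⟪x₀, z⟫_ℝ - m x₀ : ℝ) : EReal) := by
      refine (add_le_add_left hfz _).trans ?_
      rw [← EReal.coe_add, EReal.coe_le_coe_iff]
      linarith
    refine (infConv_le_coe (q := fun z : E => (k : ℝ) * ‖z‖ ^ 2 / 2) hle).trans ?_
    refine le_trans (le_of_eq ?_) (le_iSup _ x₀)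
    rw [hV, ← EReal.coe_sub, EReal.coe_eq_coe_iff, hz]
    simp only [sub_sub_cancel, norm_smul, mul_pow, norm_inv, Real.norm_natCast, inner_sub_right,
      inner_smul_right, real_inner_self_eq_norm_sq]
    field_simp
    ring

section Growth

variable [MeasurableSpace E] [BorelSpace E] (μ : Measure E)
  [μ.IsAddHaarMeasure]

/-- A convex set of finite measure with nonempty interior is bounded. -/
theorem Convex.isBounded_of_measure_ne_top {K : Set E}
    (hK : Convex ℝ K) (hKm : MeasurableSet K)
    {x₀ : E} {r : ℝ} (hr : 0 < r) (hball : Metric.ball x₀ r ⊆ K) (hfin : μ K ≠ ⊤) :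
    Bornology.IsBounded K := by
  by_contra hunb
  have hlim : Tendsto (fun n : ℕ => μ (K \ Metric.ball x₀ n)) atTop (𝓝 0) := by
    have h : (⋂ n : ℕ, K \ Metric.ball x₀ n) = ∅ := by
      rw [← sdiff_iUnion, Metric.iUnion_ball_nat, sdiff_univ]
    rw [← measure_empty (μ := μ), ← h]
    refine tendsto_measure_iInter_atTop
      (fun n => (hKm.diff Metric.isOpen_ball.measurableSet).nullMeasurableSet) ?_
      ⟨0, ne_top_of_le_ne_top hfin (measure_mono sdiff_subset)⟩
    intro a b hab
    exact sdiff_subset_sdiff_right (Metric.ball_subset_ball (by exact_mod_cast hab))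
  have hpos : 0 < μ (Metric.ball (0 : E) (r / 2)) := Metric.measure_ball_pos _ _ (by positivity)
  obtain ⟨n, hn⟩ := (hlim.eventually (gt_mem_nhds hpos)).exists
  obtain ⟨p, hp, hpn⟩ : ∃ p ∈ K, 2 * n + r < dist p x₀ := by
    by_contra! h
    exact hunb ((Metric.isBounded_iff_subset_closedBall x₀).2 ⟨_, h⟩)
  refine hn.not_ge ?_
  rw [← Measure.addHaar_ball_center μ (midpoint ℝ x₀ p)]
  refine measure_mono fun z hz => ⟨?_, ?_⟩
  · have h1 : (2 : ℝ) • z - p ∈ K := hball (by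
      rw [mem_ball_iff_norm] at hz ⊢
      have : (2 : ℝ) • z - p - x₀ = (2 : ℝ) • (z - midpoint ℝ x₀ p) := by
        rw [midpoint_eq_smul_add, invOf_eq_inv]; module
      rw [this, norm_smul, Real.norm_two]
      linarith)
    have h2 := hK h1 hp (by norm_num : (0 : ℝ) ≤ 1 / 2) (by norm_num : (0 : ℝ) ≤ 1 / 2)
      (by norm_num)
    convert h2 using 1
    module
  · rw [Metric.mem_ball] at hz ⊢
    have h1 := dist_triangle (midpoint ℝ x₀ p) z x₀
    rw [dist_midpoint_left, dist_comm _ z, Real.norm_two, dist_comm x₀ p] at h1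
    linarith

variable [FiniteDimensional ℝ E]

/-- A convex lower semicontinuous function with an affine minorant and with
`0 < ∫ e^{-g} < ∞` grows at least linearly. -/
theorem exists_linear_growth {g : E → EReal} (hg : Convex ℝ {p : E × ℝ | g p.1 ≤ p.2})
    (hlsc : LowerSemicontinuous g) {y₀ : E} (hy₀ : fenchel g y₀ ≠ ⊤)
    (hpos : ∫⁻ x, EReal.exp (-g x) ∂μ ≠ 0) (hfin : ∫⁻ x, EReal.exp (-g x) ∂μ ≠ ⊤) :
    ∃ a > 0, ∃ b : ℝ, ∀ x, ∀ r : ℝ, g x ≤ r → a * ‖x‖ - b ≤ r := by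
  obtain ⟨c, hc⟩ := exists_le_of_ne_top hy₀
  rw [fenchel_le_coe_iff] at hc
  have hmeas : Measurable fun x => EReal.exp (-g x) :=
    EReal.measurable_exp.comp hlsc.measurable.neg
  obtain ⟨t, ht⟩ : ∃ t : ℕ, μ {x | g x ≤ ((t : ℝ) : EReal)} ≠ 0 := by
    by_contra! h
    refine hpos ((lintegral_eq_zero_iff hmeas).2 ?_)
    refine measure_mono_null (fun x hx => ?_) (measure_iUnion_null h)
    rw [mem_iUnion]
    have : g x ≠ ⊤ := fun hx' => hx (by simp [hx'])
    obtain ⟨r, hr⟩ := exists_le_of_ne_top this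
    obtain ⟨n, hn⟩ := exists_nat_ge r
    exact ⟨n, hr.trans (by exact_mod_cast hn)⟩
  have hclosed : ∀ s : ℝ, IsClosed {x | g x ≤ (s : EReal)} := fun s =>
    hlsc.isClosed_preimage s
  have hconv : ∀ s : ℝ, Convex ℝ {x | g x ≤ (s : EReal)} := by
    intro s x hx y hy a b ha hb hab
    have := hg (x := (x, s)) (y := (y, s)) hx hy ha hb hab
    simpa [← add_mul, hab] using this
  have hlevel : μ {x | g x ≤ ((t + 1 : ℝ) : EReal)} ≠ ⊤ := by
    have h := mul_meas_ge_le_lintegral (μ := μ) hmeas (EReal.exp (-((t + 1 : ℝ) : EReal)))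
    simp only [EReal.exp_le_exp_iff, EReal.neg_le_neg_iff] at h
    intro htop
    rw [htop, ENNReal.mul_top] at h
    · exact hfin (top_le_iff.1 h)
    · rw [← EReal.coe_neg, EReal.exp_coe]
      exact (ENNReal.ofReal_pos.2 (Real.exp_pos _)).ne'
  obtain ⟨x₀, hx₀⟩ : (interior {x | g x ≤ ((t : ℝ) : EReal)}).Nonempty := by
    by_contra h
    rw [not_nonempty_iff_eq_empty] at h
    refine ht ?_
    have := (hconv t).addHaar_frontier μ
    rwa [(hclosed t).frontier_eq, h, sdiff_empty] at this
  obtain ⟨ρ, hρ, hball⟩ := Metric.isOpen_iff.1 isOpen_interior x₀ hx₀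
  have hx₀t : g x₀ ≤ ((t : ℝ) : EReal) :=
    (interior_subset hx₀ : x₀ ∈ {x | g x ≤ ((t : ℝ) : EReal)})
  have hbdd := (hconv (t + 1)).isBounded_of_measure_ne_top μ (hclosed _).measurableSet hρ
    ((hball.trans interior_subset).trans fun x (hx : g x ≤ _) =>
      hx.trans (by exact_mod_cast (by linarith : (t : ℝ) ≤ t + 1))) hlevel
  obtain ⟨R, hR, hsub⟩ := hbdd.subset_closedBall_lt 0 x₀
  set L := (‖x₀‖ + 2 * R) * ‖y₀‖ + c
  refine ⟨1 / (2 * R), by positivity, ‖x₀‖ / (2 * R) - min (t : ℝ) (-L - 1), fun x r hr => ?_⟩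
  have hnorm : ‖x‖ ≤ ‖x - x₀‖ + ‖x₀‖ := by simpa using norm_add_le (x - x₀) x₀
  have hdiv : 1 / (2 * R) * ‖x‖ - ‖x₀‖ / (2 * R) ≤ ‖x - x₀‖ / (2 * R) := by
    rw [one_div_mul_eq_div, ← sub_div]
    gcongr
    linarith
  suffices h : ‖x - x₀‖ / (2 * R) + min (t : ℝ) (-L - 1) ≤ r by linarith
  rcases le_or_gt ‖x - x₀‖ (2 * R) with hle | hgt
  · have h1 := hc x r hr
    have h2 : -(‖x‖ * ‖y₀‖) ≤ ⟪x, y₀⟫_ℝ := (abs_le.1 (abs_real_inner_le_norm x y₀)).1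
    have h3 : ‖x‖ * ‖y₀‖ ≤ (‖x₀‖ + 2 * R) * ‖y₀‖ := by gcongr; linarith
    have h4 : ‖x - x₀‖ / (2 * R) ≤ 1 := div_le_one_of_le₀ hle (by positivity)
    have h5 := min_le_right (t : ℝ) (-L - 1)
    linarith
  · have hd : 0 < ‖x - x₀‖ := by linarith
    set l := 2 * R / ‖x - x₀‖ with hl
    have hl0 : 0 < l := by positivity
    have hl1 : l ≤ 1 := by rw [hl, div_le_one hd]; exact hgt.le
    have h1 := hg (x := (x₀, (t : ℝ))) (y := (x, r)) hx₀t hr (sub_nonneg.2 hl1) hl0.le (by ring)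
    have h2 : ¬ (g ((1 - l) • x₀ + l • x) ≤ ((t + 1 : ℝ) : EReal)) := by
      intro h
      have h3 := hsub h
      have h4 : (1 - l) • x₀ + l • x - x₀ = l • (x - x₀) := by module
      rw [mem_closedBall_iff_norm, h4, norm_smul, Real.norm_of_nonneg hl0.le, hl,
        div_mul_cancel₀ _ hd.ne'] at h3
      linarith
    have h3 : (t + 1 : ℝ) < (1 - l) * t + l * r := by
      by_contra! h
      exact h2 (le_trans h1 (by exact_mod_cast h))
    have h4 : ‖x - x₀‖ / (2 * R) = 1 / l := by rw [hl, one_div_div]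
    have h5 : 1 / l ≤ r - t := by
      rw [div_le_iff₀ hl0]; linarith
    have h6 := min_le_left (t : ℝ) (-L - 1)
    linarith

theorem lintegral_exp_neg_norm_ne_top {a : ℝ} (ha : 0 < a) (b : ℝ) :
    ∫⁻ x, ENNReal.ofReal (Real.exp (-(a * ‖x‖ - b))) ∂μ ≠ ⊤ := by
  set N := Module.finrank ℝ E + 1 with hN
  have hint := integrable_one_add_norm (μ := μ) (r := N)
    (by rw [hN]; push_cast; linarith : (Module.finrank ℝ E : ℝ) < N)
  have hint' := (hint.const_mul (Real.exp (b + a) * (N.factorial / a ^ N))).lintegral_lt_top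
  refine ((lintegral_mono fun x => ENNReal.ofReal_le_ofReal ?_).trans_lt hint').ne
  have hx : 0 < 1 + ‖x‖ := by positivity
  have h := Real.pow_div_factorial_le_exp (a * (1 + ‖x‖)) (by positivity) N
  rw [Real.rpow_neg hx.le, Real.rpow_natCast]
  have h1 : Real.exp (-(a * ‖x‖ - b)) = Real.exp (b + a) / Real.exp (a * (1 + ‖x‖)) := by
    rw [← Real.exp_sub]; ring_nf
  have h2 : Real.exp (b + a) * (N.factorial / a ^ N) * ((1 + ‖x‖) ^ N)⁻¹
      = Real.exp (b + a) / ((a * (1 + ‖x‖)) ^ N / N.factorial) := by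
    rw [mul_pow]; field_simp
  rw [h1, h2]
  gcongr

/-- If `g □ k|·|²/2 ≤ W_k ≤ g + |·|²/(2k)` then `∫ e^{-W_k} → ∫ e^{-g}`, for `g` of at least
linear growth. -/
theorem tendsto_lintegral_exp_neg {g : E → EReal} (hlsc : LowerSemicontinuous g)
    {a b : ℝ} (ha : 0 < a) (hgrow : ∀ x, ∀ r : ℝ, g x ≤ r → a * ‖x‖ - b ≤ r)
    {W : ℕ → E → EReal} (hW : ∀ k, 1 ≤ k → Measurable (W k))
    (hlow : ∀ k : ℕ, 1 ≤ k → ∀ x,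
      infConv g (fun z => (((k : ℝ) * ‖z‖ ^ 2 / 2 : ℝ) : EReal)) x ≤ W k x)
    (hup : ∀ k : ℕ, 1 ≤ k → ∀ x, W k x ≤ g x + ((‖x‖ ^ 2 / (2 * k) : ℝ) : EReal)) :
    Tendsto (fun k => ∫⁻ x, EReal.exp (-W k x) ∂μ) atTop (𝓝 (∫⁻ x, EReal.exp (-g x) ∂μ)) := by
  refine tendsto_lintegral_filter_of_dominated_convergence
    (fun x => ENNReal.ofReal (Real.exp (-(a * ‖x‖ - (b + a ^ 2 / 2))))) ?_ ?_
    (lintegral_exp_neg_norm_ne_top μ ha _) ?_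
  · filter_upwards [eventually_ge_atTop 1] with k hk
    exact EReal.measurable_exp.comp (hW k hk).neg
  · filter_upwards [eventually_ge_atTop 1] with k hk
    refine ae_of_all _ fun x => ?_
    rw [← EReal.exp_coe, EReal.exp_le_exp_iff, EReal.coe_neg, EReal.neg_le_neg_iff]
    refine le_trans ?_ (hlow k hk x)
    refine (coe_le_infConv_iff (q := fun z => (k : ℝ) * ‖z‖ ^ 2 / 2)).2 fun u r hr => ?_
    have h1 := hgrow u r hr
    have h2 : ‖x‖ ≤ ‖x - u‖ + ‖u‖ := by simpa using norm_add_le (x - u) u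
    have h3 : a * ‖x‖ ≤ a * (‖x - u‖ + ‖u‖) := by gcongr
    have h4 : ‖x - u‖ ^ 2 ≤ k * ‖x - u‖ ^ 2 :=
      le_mul_of_one_le_left (sq_nonneg _) (by exact_mod_cast hk)
    nlinarith [sq_nonneg (a - ‖x - u‖)]
  · refine ae_of_all _ fun x => ?_
    refine (ENNReal.continuous_exp.tendsto _).comp ((continuous_neg.tendsto _).comp ?_)
    refine tendsto_order.2 ⟨fun s' hs' => ?_, fun s' hs' => ?_⟩
    · obtain ⟨s, hs's, hs⟩ := EReal.lt_iff_exists_real_btwn.1 hs'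
      obtain ⟨δ, hδ, hball⟩ := Metric.eventually_nhds_iff.1 (hlsc x s hs)
      obtain ⟨K, hK⟩ := exists_nat_ge ((s + b) * 2 / δ ^ 2)
      filter_upwards [eventually_ge_atTop 1, eventually_ge_atTop K] with k hk hkK
      refine hs's.trans_le (le_trans ?_ (hlow k hk x))
      refine (coe_le_infConv_iff (q := fun z => (k : ℝ) * ‖z‖ ^ 2 / 2)).2 fun u r hr => ?_
      rcases lt_or_ge (dist u x) δ with hlt | hge
      · have h1 : s < r := EReal.coe_lt_coe_iff.1 ((hball hlt).trans_le hr)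
        have : 0 ≤ (k : ℝ) * ‖x - u‖ ^ 2 / 2 := by positivity
        linarith
      · have h1 := hgrow u r hr
        have h2 : 0 ≤ a * ‖u‖ := by positivity
        rw [dist_comm, dist_eq_norm] at hge
        have h3 : (k : ℝ) * δ ^ 2 ≤ k * ‖x - u‖ ^ 2 := by gcongr
        have h4 : (s + b) * 2 / δ ^ 2 ≤ k := hK.trans (by exact_mod_cast hkK)
        rw [div_le_iff₀ (by positivity)] at h4
        linarith
    · have hlim : Tendsto (fun k : ℕ => g x + ((‖x‖ ^ 2 / (2 * k) : ℝ) : EReal)) atTop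
          (𝓝 (g x)) := by
        generalize g x = t at *
        induction t with
        | bot => simp
        | top => simp at hs'
        | coe t =>
          simp_rw [← EReal.coe_add]
          refine (continuous_coe_real_ereal.tendsto _).comp ?_
          have h : Tendsto (fun k : ℕ => ‖x‖ ^ 2 / (2 * (k : ℝ))) atTop (𝓝 0) :=
            tendsto_const_nhds.div_atTop
              (tendsto_natCast_atTop_atTop.const_mul_atTop two_pos)
          simpa using h.const_add t
      filter_upwards [eventually_ge_atTop 1, hlim.eventually (gt_mem_nhds hs')] with k hk h
      exact (hup k hk x).trans_lt h

end Growth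

theorem ofReal_expNeg {t : EReal} (ht : t ≠ ⊥) :
    ENNReal.ofReal (expNeg t) = EReal.exp (-t) := by
  induction t with
  | bot => exact absurd rfl ht
  | coe t => simp [expNeg, ← EReal.coe_neg]
  | top => simp [expNeg]

/-- regularization step in the proof of Corollary 2.4. For a proper convex
lsc `f : ℝⁿ → ℝ ∪ {+∞}` with `0 < ∫ e^{-f} dx ∫ e^{-f*} dx < ∞`, the functions
`V_k = (f □ k|·|²/2) + |·|²/(2k)` are real-valued and convex, their conjugates are
`V_k* = (f* + |·|²/(2k)) □ k|·|²/2` and are real-valued, and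
`∫ e^{-V_k} dx → ∫ e^{-f} dx`, `∫ e^{-V_k*} dx → ∫ e^{-f*} dx` as `k → ∞`. -/
theorem statement5 {n : ℕ} (f : EuclideanSpace ℝ (Fin n) → EReal)
    (hf : IsProperConvexLSC f)
    (hpos : 0 < (∫⁻ x, ENNReal.ofReal (expNeg (f x))) * ∫⁻ y, ENNReal.ofReal (expNeg (fenchel f y)))
    (hfin : (∫⁻ x, ENNReal.ofReal (expNeg (f x))) * (∫⁻ y, ENNReal.ofReal (expNeg (fenchel f y))) < ⊤) :
    (∀ k : ℕ, 1 ≤ k →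
        (∀ x, MYreg f k x ≠ ⊤ ∧ MYreg f k x ≠ ⊥) ∧ ConvexEReal (MYreg f k) ∧
        (∀ y, fenchel (MYreg f k) y
            = infConv (fun z => fenchel f z + ((‖z‖ ^ 2 / (2 * k) : ℝ) : EReal))
                (fun z => (((k : ℝ) * ‖z‖ ^ 2 / 2 : ℝ) : EReal)) y) ∧
        (∀ y, fenchel (MYreg f k) y ≠ ⊤ ∧ fenchel (MYreg f k) y ≠ ⊥)) ∧
    Tendsto (fun k : ℕ => ∫⁻ x, ENNReal.ofReal (expNeg (MYreg f k x))) atTop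
      (𝓝 (∫⁻ x, ENNReal.ofReal (expNeg (f x)))) ∧
    Tendsto (fun k : ℕ => ∫⁻ y, ENNReal.ofReal (expNeg (fenchel (MYreg f k) y))) atTop
      (𝓝 (∫⁻ y, ENNReal.ofReal (expNeg (fenchel f y)))) := by
  obtain ⟨hconv, hlsc, hbot, x₁, hx₁⟩ := hf
  have hepi := hconv.convex_epigraph
  have hdbot := fenchel_ne_bot hx₁
  obtain ⟨y₀, hy₀⟩ : ∃ y₀, fenchel f y₀ ≠ ⊤ := by
    by_contra! h
    simp [h, expNeg] at hpos
  obtain ⟨hI0, hJ0⟩ := mul_ne_zero_iff.1 hpos.ne'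
  have hI : ∫⁻ x, ENNReal.ofReal (expNeg (f x)) ≠ ⊤ := fun h => by
    rw [h, ENNReal.top_mul hJ0] at hfin
    exact hfin.ne rfl
  have hJ : ∫⁻ y, ENNReal.ofReal (expNeg (fenchel f y)) ≠ ⊤ := fun h => by
    rw [h, ENNReal.mul_top hI0] at hfin
    exact hfin.ne rfl
  have hreal : ∀ k : ℕ, 1 ≤ k → ∃ v : EuclideanSpace ℝ (Fin n) → ℝ, ConvexOn ℝ univ v ∧
      MYreg f k = fun x => (v x : EReal) := by
    intro k hk
    have hk0 : (0 : ℝ) < k := by exact_mod_cast hk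
    obtain ⟨m, hm, hmf⟩ := exists_convexOn_infConv_eq hepi hx₁ hy₀ hk0
    refine ⟨fun x => m x + (2 * (k : ℝ))⁻¹ • ‖x‖ ^ 2, hm.add (ConvexOn.smul (by positivity)
      ((convexOn_norm convex_univ).pow (fun _ _ => norm_nonneg _) 2)), funext fun x => ?_⟩
    rw [MYreg, hmf, ← EReal.coe_add]
    simp only [smul_eq_mul, inv_mul_eq_div]
  have hdual := fun (k : ℕ) (hk : 1 ≤ k) y => fenchel_MYreg hepi hx₁ hy₀ hk y
  have hVne : ∀ k : ℕ, 1 ≤ k → ∀ x, MYreg f k x ≠ ⊤ ∧ MYreg f k x ≠ ⊥ := by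
    intro k hk x
    obtain ⟨v, -, hv⟩ := hreal k hk
    simp [hv]
  have hVdne : ∀ k : ℕ, 1 ≤ k → ∀ y, fenchel (MYreg f k) y ≠ ⊤ ∧ fenchel (MYreg f k) y ≠ ⊥ := by
    intro k hk y
    refine ⟨?_, fenchel_ne_bot (hVne k hk 0).1 y⟩
    obtain ⟨c, hc⟩ := exists_le_of_ne_top hy₀
    have h : fenchel f y₀ + ((‖y₀‖ ^ 2 / (2 * k) : ℝ) : EReal) ≤
        ((c + ‖y₀‖ ^ 2 / (2 * k) : ℝ) : EReal) := by
      rw [EReal.coe_add]; gcongr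
    rw [hdual k hk]
    exact ((infConv_le_coe (q := fun z : EuclideanSpace ℝ (Fin n) => (k : ℝ) * ‖z‖ ^ 2 / 2) h).trans_lt
      (EReal.coe_lt_top _)).ne
  have hself : ∀ (g : EuclideanSpace ℝ (Fin n) → EReal) (k : ℕ) x,
      infConv g (fun z => (((k : ℝ) * ‖z‖ ^ 2 / 2 : ℝ) : EReal)) x ≤ g x := fun g k x =>
    (iInf_le _ x).trans (by simp)
  have hnn : ∀ (k : ℕ) (x : EuclideanSpace ℝ (Fin n)),
      (0 : EReal) ≤ ((‖x‖ ^ 2 / (2 * k) : ℝ) : EReal) := fun k x => by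
    exact_mod_cast (by positivity : 0 ≤ ‖x‖ ^ 2 / (2 * (k : ℝ)))
  refine ⟨fun k hk => ⟨hVne k hk, ?_, hdual k hk, hVdne k hk⟩, ?_, ?_⟩
  · obtain ⟨v, hv, hv'⟩ := hreal k hk
    rw [hv']
    exact hv.convexEReal
  · simp only [ofReal_expNeg (hbot _)] at hI0 hI ⊢
    obtain ⟨a, ha, b, hab⟩ := exists_linear_growth volume hepi hlsc hy₀ hI0 hI
    refine (tendsto_lintegral_exp_neg volume hlsc ha hab (W := MYreg f)
      (fun k hk => ?_) (fun k _ x => le_add_of_nonneg_right (hnn k x))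
      (fun k _ x => add_le_add_left (hself f k x) _)).congr' ?_
    · obtain ⟨v, hv, hv'⟩ := hreal k hk
      rw [hv']
      exact (continuous_coe_real_ereal.comp hv.locallyLipschitz.continuous).measurable
    · filter_upwards [eventually_ge_atTop 1] with k hk
      exact lintegral_congr fun x => (ofReal_expNeg (hVne k hk x).2).symm
  · simp only [ofReal_expNeg (hdbot _)] at hJ0 hJ ⊢
    obtain ⟨a, ha, b, hab⟩ := exists_linear_growth volume (convex_epigraph_fenchel f)
      (lowerSemicontinuous_fenchel f) (fenchel_fenchel_ne_top hx₁) hJ0 hJ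
    refine (tendsto_lintegral_exp_neg volume (lowerSemicontinuous_fenchel f) ha hab
      (W := fun k => fenchel (MYreg f k))
      (fun k _ => (lowerSemicontinuous_fenchel _).measurable) (fun k hk y => ?_)
      (fun k hk y => ?_)).congr' ?_
    · rw [hdual k hk]
      exact iInf_mono fun z => add_le_add_left (le_add_of_nonneg_right (hnn k z)) _
    · rw [hdual k hk]
      exact hself _ k y
    · filter_upwards [eventually_ge_atTop 1] with k hk
      exact lintegral_congr fun y => (ofReal_expNeg (hVdne k hk y).2).symm

end
end

section
/- Let η₁, η₂ be probability measures on ℝ with finite first moments such that 𝒯(η₁, η₂) is finite. Then 𝒯(η₁, η₂) ≥ ∫₀¹ F_{η₁}^{-1}(x) · F_{η₂}^{-1}(x) dx, with equality when η₁, η₂ have finite second moments. -/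
open MeasureTheory Real Set
open scoped ENNReal InnerProductSpace

noncomputable section

variable {E : Type*} [NormedAddCommGroup E] [InnerProductSpace ℝ E]

/-- positive part of an extended real, as `ℝ≥0∞`. -/
def ERealPos (t : EReal) : ℝ≥0∞ := if t = ⊤ then ⊤ else ENNReal.ofReal t.toReal

/-- Integral of an extended-real-valued function, with value in `EReal`. -/
def eintegral {α : Type*} [MeasurableSpace α] (μ : Measure α) (g : α → EReal) : EReal :=
  ((∫⁻ x, ERealPos (g x) ∂μ : ℝ≥0∞) : EReal) - ((∫⁻ x, ERealPos (-(g x)) ∂μ : ℝ≥0∞) : EReal)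

variable [MeasurableSpace E]

/-- The maximal correlation transport cost `𝒯(μ₁, μ₂)`. -/
def mcCost (μ₁ μ₂ : Measure E) : EReal :=
  ⨅ f : {f : E → EReal // IsProperConvexLSC f},
    eintegral μ₁ f.1 + eintegral μ₂ (fenchel f.1)

/-- The generalized inverse `F_μ^{-1}` of the cumulative distribution function
`F_μ(x) = μ((-∞, x])` of a probability measure `μ` on `ℝ`. -/
def qf (μ : Measure ℝ) (t : ℝ) : ℝ := sInf {x : ℝ | t ≤ (μ (Iic x)).toReal}

/-! ### Extended-real-valued integrals -/

lemma ERealPos_coe (x : ℝ) : ERealPos (x : EReal) = ENNReal.ofReal x := by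
  simp [ERealPos]

lemma ERealPos_mono : Monotone ERealPos := by
  intro s t hst
  induction t with
  | top => simp [ERealPos]
  | bot => simp [le_bot_iff.1 hst]
  | coe t =>
    induction s with
    | top => simp at hst
    | bot => simp [ERealPos]
    | coe s =>
      rw [ERealPos_coe, ERealPos_coe]
      exact ENNReal.ofReal_le_ofReal (EReal.coe_le_coe_iff.1 hst)

lemma measurable_ERealPos : Measurable ERealPos :=
  ERealPos_mono.measurable

section eintegral

variable {α β : Type*} [MeasurableSpace α] [MeasurableSpace β] {ν : Measure α}

lemma eintegral_mono_ae {g g' : α → EReal} (h : ∀ᵐ x ∂ν, g x ≤ g' x) :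
    eintegral ν g ≤ eintegral ν g' := by
  refine EReal.sub_le_sub ?_ ?_
  · refine EReal.coe_ennreal_le_coe_ennreal_iff.2 (lintegral_mono_ae ?_)
    filter_upwards [h] with x hx using ERealPos_mono hx
  · refine EReal.coe_ennreal_le_coe_ennreal_iff.2 (lintegral_mono_ae ?_)
    filter_upwards [h] with x hx using ERealPos_mono (EReal.neg_le_neg_iff.2 hx)

lemma eintegral_congr_ae {g g' : α → EReal} (h : ∀ᵐ x ∂ν, g x = g' x) :
    eintegral ν g = eintegral ν g' :=
  le_antisymm (eintegral_mono_ae (h.mono fun _ hx => hx.le))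
    (eintegral_mono_ae (h.mono fun _ hx => hx.ge))

lemma eintegral_map {q : α → β} (hq : AEMeasurable q ν) {g : β → EReal} (hg : Measurable g) :
    eintegral (ν.map q) g = eintegral ν (fun x => g (q x)) := by
  have hpos : Measurable fun y => ERealPos (g y) := measurable_ERealPos.comp hg
  have hneg : Measurable fun y => ERealPos (-(g y)) := measurable_ERealPos.comp hg.neg
  simp only [eintegral, lintegral_map' hpos.aemeasurable hq, lintegral_map' hneg.aemeasurable hq]

lemma eintegral_coe {u : α → ℝ} (hu : Integrable u ν) :
    eintegral ν (fun x => (u x : EReal)) = ((∫ x, u x ∂ν : ℝ) : EReal) := by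
  have hpos : ∫⁻ x, ENNReal.ofReal (u x) ∂ν ≠ ⊤ := hu.lintegral_lt_top.ne
  have hneg : ∫⁻ x, ENNReal.ofReal (-u x) ∂ν ≠ ⊤ := hu.neg.lintegral_lt_top.ne
  rw [integral_eq_lintegral_pos_part_sub_lintegral_neg_part hu, EReal.coe_sub,
    EReal.coe_ennreal_toReal hpos, EReal.coe_ennreal_toReal hneg]
  simp only [eintegral, ← EReal.coe_neg, ERealPos_coe]

lemma exists_integrable_of_eintegral_finite {g : α → EReal} (hg : AEMeasurable g ν)
    (hbot : eintegral ν g ≠ ⊥) (htop : eintegral ν g ≠ ⊤) :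
    ∃ u : α → ℝ, Integrable u ν ∧ ∀ᵐ x ∂ν, g x = u x := by
  have hN : ∫⁻ x, ERealPos (-(g x)) ∂ν ≠ ⊤ := by
    intro h
    simp [eintegral, h] at hbot
  have hP : ∫⁻ x, ERealPos (g x) ∂ν ≠ ⊤ := by
    intro h
    apply htop
    rw [eintegral, h, EReal.coe_ennreal_top]
    exact EReal.top_sub (by simpa using hN)
  have mP : AEMeasurable (fun x => ERealPos (g x)) ν := measurable_ERealPos.comp_aemeasurable hg
  have mN : AEMeasurable (fun x => ERealPos (-(g x))) ν :=
    measurable_ERealPos.comp_aemeasurable hg.neg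
  have hfin : ∀ᵐ x ∂ν, g x = ((g x).toReal : EReal) := by
    filter_upwards [ae_lt_top' mP hP, ae_lt_top' mN hN] with x hx hx'
    refine (EReal.coe_toReal ?_ ?_).symm
    · intro h
      simp [h, ERealPos] at hx
    · intro h
      simp [h, ERealPos] at hx'
  refine ⟨fun x => (g x).toReal, ⟨?_, ?_⟩, hfin⟩
  · exact (measurable_ereal_toReal.comp_aemeasurable hg).aestronglyMeasurable
  · have hle : ∫⁻ x, ‖(g x).toReal‖ₑ ∂ν
        ≤ ∫⁻ x, (ERealPos (g x) + ERealPos (-(g x))) ∂ν := by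
      refine lintegral_mono_ae ?_
      filter_upwards [hfin] with x hx
      rw [hx, ← EReal.coe_neg, ERealPos_coe, ERealPos_coe, EReal.toReal_coe,
        Real.enorm_eq_ofReal_abs]
      rcases abs_cases (g x).toReal with h | h <;> rw [h.1]
      · exact le_self_add
      · exact le_add_self
    rw [lintegral_add_left' mP] at hle
    exact hle.trans_lt (ENNReal.add_lt_top.2 ⟨hP.lt_top, hN.lt_top⟩)

end eintegral

/-! ### Quantile functions -/

section quantile

open ProbabilityTheory

variable (μ : Measure ℝ) [IsProbabilityMeasure μ]

lemma qf_le_iff {t : ℝ} (ht : t ∈ Ioo (0 : ℝ) 1) (x : ℝ) :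
    qf μ t ≤ x ↔ t ≤ (μ (Iic x)).toReal := by
  have hF : ∀ y, (μ (Iic y)).toReal = cdf μ y := fun y => (cdf_eq_real μ y).symm
  simp only [qf, hF]
  obtain ⟨u, hu⟩ := ((tendsto_cdf_atTop μ).eventually (eventually_ge_nhds ht.2)).exists
  obtain ⟨l, hl⟩ := ((tendsto_cdf_atBot μ).eventually (eventually_lt_nhds ht.1)).exists
  have hbdd : BddBelow {y | t ≤ cdf μ y} :=
    ⟨l, fun y hy => le_of_not_gt fun h => (hy.trans ((cdf μ).mono h.le)).not_gt hl⟩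
  refine ⟨fun h => ?_, fun h => csInf_le hbdd h⟩
  refine le_trans ?_ ((cdf μ).mono h)
  set m := sInf {y | t ≤ cdf μ y}
  have hc : Filter.Tendsto (cdf μ) (nhdsWithin m (Ioi m)) (nhds (cdf μ m)) :=
    ((cdf μ).right_continuous m).mono_left (nhdsWithin_mono _ Ioi_subset_Ici_self)
  refine ge_of_tendsto hc ?_
  filter_upwards [self_mem_nhdsWithin] with y hy
  obtain ⟨z, hz, hzy⟩ := exists_lt_of_csInf_lt ⟨u, hu⟩ (mem_Ioi.1 hy)
  exact le_trans hz ((cdf μ).mono hzy.le)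

lemma monotoneOn_qf : MonotoneOn (qf μ) (Ioo 0 1) := fun _ hs _ ht hst =>
  (qf_le_iff μ hs _).2 (hst.trans ((qf_le_iff μ ht _).1 le_rfl))

lemma aemeasurable_qf : AEMeasurable (qf μ) (volume.restrict (Ioo 0 1)) :=
  aemeasurable_restrict_of_monotoneOn measurableSet_Ioo (monotoneOn_qf μ)

lemma map_qf : (volume.restrict (Ioo (0 : ℝ) 1)).map (qf μ) = μ := by
  have hfin : IsFiniteMeasure ((volume.restrict (Ioo (0 : ℝ) 1)).map (qf μ)) := inferInstance
  refine Measure.ext_of_Iic _ _ fun x => ?_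
  rw [Measure.map_apply_of_aemeasurable (aemeasurable_qf μ) measurableSet_Iic,
    Measure.restrict_apply' measurableSet_Ioo]
  have hF1 : (μ (Iic x)).toReal ≤ 1 := measureReal_le_one
  have hset : qf μ ⁻¹' Iic x ∩ Ioo 0 1 = Iic (μ (Iic x)).toReal ∩ Ioo 0 1 := by
    ext t
    simp only [mem_inter_iff, mem_preimage, mem_Iic]
    exact and_congr_left fun ht => qf_le_iff μ ht x
  rw [hset]
  refine le_antisymm ?_ ?_
  · refine (measure_mono (t := Ioc 0 (μ (Iic x)).toReal) fun t ht => ⟨ht.2.1, ht.1⟩).trans ?_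
    simp
  · refine le_trans ?_ (measure_mono (s := Ioo 0 (μ (Iic x)).toReal) fun t ht =>
      ⟨ht.2.le, ht.1, ht.2.trans_le hF1⟩)
    simp

lemma integrable_comp_qf {u : ℝ → ℝ} (hu : Integrable u μ) :
    Integrable (fun t => u (qf μ t)) (volume.restrict (Ioo 0 1)) := by
  rw [← map_qf μ] at hu
  exact hu.comp_aemeasurable (aemeasurable_qf μ)

lemma eintegral_eq_eintegral_qf {g : ℝ → EReal} (hg : Measurable g) :
    eintegral μ g = eintegral (volume.restrict (Ioo (0 : ℝ) 1)) (fun t => g (qf μ t)) := by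
  conv_lhs => rw [← map_qf μ]
  exact eintegral_map (aemeasurable_qf μ) hg

end quantile

/-! ### Fenchel transforms on the line -/

lemma inner_real_eq_mul (x y : ℝ) : inner ℝ x y = x * y := by
  simp [mul_comm]

lemma measurable_fenchel {f : ℝ → EReal} (hf : ∀ x, f x ≠ ⊥) : Measurable (fenchel f) := by
  refine LowerSemicontinuous.measurable (lowerSemicontinuous_iSup fun x => ?_)
  refine Continuous.lowerSemicontinuous ?_
  have hfx := hf x
  generalize f x = c at hfx
  induction c with
  | bot => exact absurd rfl hfx
  | top => simpa using continuous_const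
  | coe c =>
    simp only [← EReal.coe_sub]
    exact continuous_coe_real_ereal.comp (by fun_prop)

/-- A supremum of a nonempty family of affine functions, finite at some point, is proper convex and
lower semicontinuous. -/
lemma isProperConvexLSC_iSup_affine {ι : Type*} (p c : ι → ℝ) [Nonempty ι] {x₀ : ℝ}
    (hx₀ : (⨆ i, ((p i * x₀ + c i : ℝ) : EReal)) ≠ ⊤) :
    IsProperConvexLSC (fun x : ℝ => ⨆ i, ((p i * x + c i : ℝ) : EReal)) := by
  refine ⟨fun x y a b ha hb hab => iSup_le fun i => ?_, lowerSemicontinuous_iSup fun i => ?_,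
    fun x => ?_, x₀, hx₀⟩
  · have hsplit : p i * (a • x + b • y) + c i = a * (p i * x + c i) + b * (p i * y + c i) := by
      simp only [smul_eq_mul]
      linear_combination (-c i) * hab
    rw [hsplit, EReal.coe_add, EReal.coe_mul, EReal.coe_mul]
    refine add_le_add (mul_le_mul_of_nonneg_left ?_ (EReal.coe_nonneg.2 ha))
      (mul_le_mul_of_nonneg_left ?_ (EReal.coe_nonneg.2 hb))
    · exact le_iSup (fun i => ((p i * x + c i : ℝ) : EReal)) i
    · exact le_iSup (fun i => ((p i * y + c i : ℝ) : EReal)) i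
  · exact (continuous_coe_real_ereal.comp (by fun_prop)).lowerSemicontinuous
  · obtain ⟨i⟩ := ‹Nonempty ι›
    exact ((EReal.bot_lt_coe _).trans_le
      (le_iSup (fun i => ((p i * x + c i : ℝ) : EReal)) i)).ne'

/-- For `a` and `b` monotone on `S`, there is a potential `C`, namely a Stieltjes integral of `b`
against `a`, whose increments dominate those of `a` weighted by `b`. -/
lemma exists_potential {S : Set ℝ} {a b : ℝ → ℝ} (ha : MonotoneOn a S) (hb : MonotoneOn b S) :
    ∃ C : ℝ → ℝ, ∀ s ∈ S, ∀ t ∈ S, C t + (a s - a t) * b t ≤ C s := by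
  rcases S.eq_empty_or_nonempty with rfl | ⟨r, hr⟩
  · exact ⟨0, by simp⟩
  let h : ℝ → ℝ := fun x => sSup (b '' {u ∈ S | a u ≤ x})
  have upper : ∀ s ∈ S, ∀ x < a s, b s ∈ upperBounds (b '' {u ∈ S | a u ≤ x}) := by
    rintro s hs x hx _ ⟨u, ⟨hu, hux⟩, rfl⟩
    refine hb hu hs (le_of_not_gt fun hsu => ?_)
    exact (hux.trans_lt hx).not_ge (ha hs hu hsu.le)
  have le_h : ∀ t ∈ S, ∀ s ∈ S, ∀ x ∈ Ioo (a t) (a s), b t ≤ h x := fun t ht s hs x hx =>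
    le_csSup ⟨_, upper s hs x hx.2⟩ ⟨t, ⟨ht, hx.1.le⟩, rfl⟩
  have h_le : ∀ t ∈ S, ∀ s ∈ S, ∀ x ∈ Ioo (a t) (a s), h x ≤ b s := fun t ht s hs x hx =>
    csSup_le ⟨_, t, ⟨ht, hx.1.le⟩, rfl⟩ (upper s hs x hx.2)
  have int_le : ∀ t ∈ S, ∀ s ∈ S, a t ≤ a s → IntervalIntegrable h volume (a t) (a s) := by
    intro t ht s hs hts
    rw [intervalIntegrable_iff_integrableOn_Ioo_of_le hts]
    have hmono : MonotoneOn h (Ioo (a t) (a s)) := fun x hx y hy hxy =>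
      csSup_le_csSup ⟨_, upper s hs y hy.2⟩ ⟨_, t, ⟨ht, hx.1.le⟩, rfl⟩
        (image_mono fun u hu => ⟨hu.1, hu.2.trans hxy⟩)
    refine IntegrableOn.of_bound measure_Ioo_lt_top
      (aemeasurable_restrict_of_monotoneOn measurableSet_Ioo hmono).aestronglyMeasurable
      (max |b t| |b s|) ?_
    refine (ae_restrict_iff' measurableSet_Ioo).2 (.of_forall fun x hx => ?_)
    exact abs_le_max_abs_abs (le_h t ht s hs x hx) (h_le t ht s hs x hx)
  have int : ∀ t ∈ S, ∀ s ∈ S, IntervalIntegrable h volume (a t) (a s) := fun t ht s hs =>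
    (le_total (a t) (a s)).elim (int_le t ht s hs) fun hst => (int_le s hs t ht hst).symm
  refine ⟨fun s => ∫ x in a r..a s, h x, fun s hs t ht => ?_⟩
  have hsub := intervalIntegral.integral_interval_sub_left (int r hr s hs) (int r hr t ht)
  suffices (a s - a t) * b t ≤ ∫ x in a t..a s, h x by linarith
  rcases le_total (a t) (a s) with hts | hst
  · have := intervalIntegral.integral_mono_on_of_le_Ioo hts
      (intervalIntegrable_const (c := b t)) (int t ht s hs) (le_h t ht s hs)
    simpa using this
  · have := intervalIntegral.integral_mono_on_of_le_Ioo hst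
      (int s hs t ht) (intervalIntegrable_const (c := b t)) (h_le s hs t ht)
    rw [intervalIntegral.integral_symm]
    simp only [intervalIntegral.integral_const, smul_eq_mul] at this
    linarith

/-- A monotone curve `(a, b)` lies in the subdifferential of a proper convex lower semicontinuous
function `f`: the Fenchel inequality is an equality along the curve. -/
lemma exists_isProperConvexLSC_fenchel_eq {S : Set ℝ} (hS : S.Nonempty) {a b : ℝ → ℝ}
    (ha : MonotoneOn a S) (hb : MonotoneOn b S) :
    ∃ (f : ℝ → EReal) (C : ℝ → ℝ), IsProperConvexLSC f ∧
      (∀ s ∈ S, ∀ t ∈ S, C t + (a s - a t) * b t ≤ C s) ∧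
      (∀ t ∈ S, f (a t) = C t) ∧
      ∀ t ∈ S, fenchel f (b t) = ((a t * b t - C t : ℝ) : EReal) := by
  obtain ⟨C, hC⟩ := exists_potential ha hb
  have : Nonempty S := hS.to_subtype
  let c : S → ℝ := fun t => C t - a t * b t
  let f : ℝ → EReal := fun x => ⨆ t : S, ((b t * x + c t : ℝ) : EReal)
  have hf : ∀ t ∈ S, f (a t) = C t := by
    intro t ht
    refine le_antisymm (iSup_le fun s => ?_) ?_
    · have := hC t ht s s.2
      exact EReal.coe_le_coe_iff.2 (by simp only [c]; linarith)
    · refine le_trans ?_ (le_iSup (fun s : S => ((b s * a t + c s : ℝ) : EReal)) ⟨t, ht⟩)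
      exact EReal.coe_le_coe_iff.2 (by simp only [c]; linarith)
  refine ⟨f, C, ?_, hC, hf, fun t ht => le_antisymm (iSup_le fun x => ?_) ?_⟩
  · obtain ⟨t, ht⟩ := hS
    exact isProperConvexLSC_iSup_affine _ _ (x₀ := a t) (by
      rw [show (⨆ s : S, ((b s * a t + c s : ℝ) : EReal)) = C t from hf t ht]
      exact EReal.coe_ne_top _)
  · have hle : ((b t * x + (C t - a t * b t) : ℝ) : EReal) ≤ f x :=
      le_iSup (fun s : S => ((b s * x + c s : ℝ) : EReal)) ⟨t, ht⟩
    refine (EReal.sub_le_sub le_rfl hle).trans ?_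
    rw [← EReal.coe_sub, EReal.coe_le_coe_iff, inner_real_eq_mul]
    linarith
  · refine le_trans ?_ (le_iSup (fun x : ℝ => ((inner ℝ x (b t) : ℝ) : EReal) - f x) (a t))
    rw [hf t ht, ← EReal.coe_sub, EReal.coe_le_coe_iff, inner_real_eq_mul]

lemma eintegral_qf_mul_le (μ₁ μ₂ : Measure ℝ) [IsProbabilityMeasure μ₁] [IsProbabilityMeasure μ₂]
    {f : ℝ → EReal} (hf : IsProperConvexLSC f)
    (hbot : eintegral μ₁ f + eintegral μ₂ (fenchel f) ≠ ⊥) :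
    eintegral (volume.restrict (Ioo (0 : ℝ) 1)) (fun t => ((qf μ₁ t * qf μ₂ t : ℝ) : EReal))
      ≤ eintegral μ₁ f + eintegral μ₂ (fenchel f) := by
  by_cases htop : eintegral μ₁ f + eintegral μ₂ (fenchel f) = ⊤
  · rw [htop]
    exact le_top
  have mf : Measurable f := hf.2.1.measurable
  have mf' : Measurable (fenchel f) := measurable_fenchel hf.2.2.1
  rw [eintegral_eq_eintegral_qf μ₁ mf, eintegral_eq_eintegral_qf μ₂ mf'] at hbot htop ⊢
  obtain ⟨hb1, hb2⟩ := not_or.1 (mt EReal.add_eq_bot_iff.2 hbot)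
  obtain ⟨u, hu, hfu⟩ := exists_integrable_of_eintegral_finite
    (g := fun t => f (qf μ₁ t)) (mf.comp_aemeasurable (aemeasurable_qf μ₁)) hb1
    fun h => htop (by rw [h]; exact EReal.top_add_of_ne_bot hb2)
  obtain ⟨v, hv, hfv⟩ := exists_integrable_of_eintegral_finite
    (g := fun t => fenchel f (qf μ₂ t)) (mf'.comp_aemeasurable (aemeasurable_qf μ₂)) hb2
    fun h => htop (by rw [h]; exact EReal.add_top_of_ne_bot hb1)
  rw [eintegral_congr_ae hfu, eintegral_congr_ae hfv, eintegral_coe hu, eintegral_coe hv,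
    ← EReal.coe_add, ← integral_add' hu hv, ← eintegral_coe (hu.add hv)]
  refine eintegral_mono_ae ?_
  filter_upwards [hfu, hfv] with t hut hvt
  have hle : ((inner ℝ (qf μ₁ t) (qf μ₂ t) : ℝ) : EReal) - f (qf μ₁ t) ≤ fenchel f (qf μ₂ t) :=
    le_iSup (fun x : ℝ => ((inner ℝ x (qf μ₂ t) : ℝ) : EReal) - f x) (qf μ₁ t)
  rw [hut, hvt, ← EReal.coe_sub, EReal.coe_le_coe_iff, inner_real_eq_mul] at hle
  rw [EReal.coe_le_coe_iff]
  simp only [Pi.add_apply]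
  linarith

lemma mcCost_le_eintegral_qf_mul (μ₁ μ₂ : Measure ℝ) [IsProbabilityMeasure μ₁]
    [IsProbabilityMeasure μ₂] (h₁ : Integrable (fun x : ℝ => x) μ₁)
    (h₂ : Integrable (fun x : ℝ => x) μ₂)
    (hs₁ : Integrable (fun x : ℝ => x ^ 2) μ₁) (hs₂ : Integrable (fun x : ℝ => x ^ 2) μ₂) :
    mcCost μ₁ μ₂ ≤
      eintegral (volume.restrict (Ioo (0 : ℝ) 1))
        (fun t => ((qf μ₁ t * qf μ₂ t : ℝ) : EReal)) := by
  have hr : (1 / 2 : ℝ) ∈ Ioo (0 : ℝ) 1 := by norm_num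
  obtain ⟨f, C, hf, hC, hfC, hfD⟩ :=
    exists_isProperConvexLSC_fenchel_eq ⟨_, hr⟩ (monotoneOn_qf μ₁) (monotoneOn_qf μ₂)
  set ν : Measure ℝ := volume.restrict (Ioo (0 : ℝ) 1)
  have mem : ∀ᵐ t ∂ν, t ∈ Ioo (0 : ℝ) 1 := ae_restrict_mem measurableSet_Ioo
  have mf : Measurable f := hf.2.1.measurable
  have i₁ : Integrable (qf μ₁) ν := integrable_comp_qf μ₁ h₁
  have i₂ : Integrable (qf μ₂) ν := integrable_comp_qf μ₂ h₂
  have i₁₂ : Integrable (fun t => qf μ₁ t * qf μ₂ t) ν :=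
    MemLp.integrable_mul
      ((memLp_two_iff_integrable_sq i₁.1).2 (integrable_comp_qf μ₁ hs₁))
      ((memLp_two_iff_integrable_sq i₂.1).2 (integrable_comp_qf μ₂ hs₂))
  have mC : AEMeasurable C ν := by
    refine (measurable_ereal_toReal.comp_aemeasurable
      (mf.comp_aemeasurable (aemeasurable_qf μ₁))).congr ?_
    filter_upwards [mem] with t ht
    simp [hfC t ht]
  have iC : Integrable C ν := by
    have hlow : Integrable (fun t => C (1 / 2) + (qf μ₁ t - qf μ₁ (1 / 2)) * qf μ₂ (1 / 2)) ν :=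
      (integrable_const _).add ((i₁.sub (integrable_const _)).mul_const _)
    have hupp : Integrable (fun t => C (1 / 2) +
        (qf μ₁ t * qf μ₂ t - qf μ₁ (1 / 2) * qf μ₂ t)) ν :=
      (integrable_const _).add (i₁₂.sub (i₂.const_mul _))
    refine integrable_of_le_of_le mC.aestronglyMeasurable ?_ ?_ hlow hupp
    · filter_upwards [mem] with t ht using hC t ht _ hr
    · filter_upwards [mem] with t ht
      have := hC _ hr t ht
      linarith
  have iD : Integrable (fun t => qf μ₁ t * qf μ₂ t - C t) ν := i₁₂.sub iC
  refine (iInf_le _ (⟨f, hf⟩ : {f : ℝ → EReal // IsProperConvexLSC f})).trans ?_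
  simp only
  rw [eintegral_eq_eintegral_qf μ₁ mf,
    eintegral_eq_eintegral_qf μ₂ (measurable_fenchel hf.2.2.1),
    eintegral_congr_ae (mem.mono fun t ht => hfC t ht),
    eintegral_congr_ae (mem.mono fun t ht => hfD t ht),
    eintegral_coe iC, eintegral_coe iD, eintegral_coe i₁₂, ← EReal.coe_add,
    integral_sub i₁₂ iC]
  simp

/-- Lemma 3.1, first part. For probability measures `η₁, η₂` on `ℝ` with
finite first moments and `𝒯(η₁, η₂)` finite, one has
`𝒯(η₁, η₂) ≥ ∫₀¹ F_{η₁}^{-1}(x) F_{η₂}^{-1}(x) dx`, with equality when `η₁, η₂` have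
finite second moments. -/
theorem statement6 (η₁ η₂ : Measure ℝ) [IsProbabilityMeasure η₁] [IsProbabilityMeasure η₂]
    (h1 : Integrable (fun x : ℝ => x) η₁) (h2 : Integrable (fun x : ℝ => x) η₂)
    (hTtop : mcCost η₁ η₂ ≠ ⊤) (hTbot : mcCost η₁ η₂ ≠ ⊥) :
    eintegral (volume.restrict (Ioo (0:ℝ) 1)) (fun t => ((qf η₁ t * qf η₂ t : ℝ) : EReal))
        ≤ mcCost η₁ η₂ ∧
      (Integrable (fun x : ℝ => x ^ 2) η₁ → Integrable (fun x : ℝ => x ^ 2) η₂ →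
        mcCost η₁ η₂
          = eintegral (volume.restrict (Ioo (0:ℝ) 1)) (fun t => ((qf η₁ t * qf η₂ t : ℝ) : EReal))) := by
  refine ⟨le_iInf fun f => ?_, fun hs1 hs2 => le_antisymm ?_ (le_iInf fun f => ?_)⟩
  · exact eintegral_qf_mul_le η₁ η₂ f.2 (ne_bot_of_le_ne_bot hTbot (iInf_le _ f))
  · exact mcCost_le_eintegral_qf_mul η₁ η₂ h1 h2 hs1 hs2
  · exact eintegral_qf_mul_le η₁ η₂ f.2 (ne_bot_of_le_ne_bot hTbot (iInf_le _ f))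


end
end
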